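/- arXiv:2311.11064 — 2 statements merged into one kernel-verified Lean document; each statement's English description precedes it below -/
import Mathlib

section
/- For every real x > 0, ∑_{j=0}^{∞} (2^{4j+1} π^{4j} (2j)! / (4j+2)!) · x^{2j} ≤ √π · cosh(π² x) ≤ √π · exp(π² x). -/
theorem aux_fact (n : ℕ) :
    2 ^ (2 * n + 1) * (Nat.factorial n * Nat.factorial n) ≤ Nat.factorial (2 * n + 2) := by
  induction n with
  | zero => decide
  | succ n ih =>
    have h1 : Nat.factorial (2 * (n + 1) + 2)
        = (2 * n + 4) * ((2 * n + 3) * Nat.factorial (2 * n + 2)) := by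
      rw [show 2 * (n + 1) + 2 = (2 * n + 2 + 1) + 1 by ring, Nat.factorial_succ,
        Nat.factorial_succ]
    rw [h1, Nat.factorial_succ]
    calc 2 ^ (2 * (n + 1) + 1) * ((n + 1) * Nat.factorial n * ((n + 1) * Nat.factorial n))
        = (2 * n + 2) * ((2 * n + 2) *
          (2 ^ (2 * n + 1) * (Nat.factorial n * Nat.factorial n))) := by ring
      _ ≤ _ := by gcongr <;> omega

/-- For every real `x > 0`,
`∑_{j=0}^∞ (2^(4j+1) π^(4j) (2j)! / (4j+2)!) x^(2j) ≤ √π cosh(π² x) ≤ √π exp(π² x)`. -/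
theorem stmt_4 (x : ℝ) (hx : 0 < x) :
    Summable
      (fun j : ℕ =>
        2 ^ (4 * j + 1) * Real.pi ^ (4 * j) * (Nat.factorial (2 * j) : ℝ) /
            (Nat.factorial (4 * j + 2) : ℝ) * x ^ (2 * j)) ∧
    (∑' j : ℕ,
        2 ^ (4 * j + 1) * Real.pi ^ (4 * j) * (Nat.factorial (2 * j) : ℝ) /
            (Nat.factorial (4 * j + 2) : ℝ) * x ^ (2 * j)) ≤
      Real.sqrt Real.pi * Real.cosh (Real.pi ^ 2 * x) ∧
    Real.sqrt Real.pi * Real.cosh (Real.pi ^ 2 * x) ≤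
      Real.sqrt Real.pi * Real.exp (Real.pi ^ 2 * x) := by
  have hs := Real.hasSum_cosh (Real.pi ^ 2 * x)
  have hle : ∀ j : ℕ, 2 ^ (4 * j + 1) * Real.pi ^ (4 * j) * (Nat.factorial (2 * j) : ℝ) /
      (Nat.factorial (4 * j + 2) : ℝ) * x ^ (2 * j)
      ≤ (Real.pi ^ 2 * x) ^ (2 * j) / (Nat.factorial (2 * j) : ℝ) := by
    intro j
    have h := aux_fact (2 * j)
    rw [show 2 * (2 * j) = 4 * j by ring] at h
    have h' : (2 : ℝ) ^ (4 * j + 1) * ((Nat.factorial (2 * j) : ℝ) * (Nat.factorial (2 * j) : ℝ))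
        ≤ (Nat.factorial (4 * j + 2) : ℝ) := by exact_mod_cast h
    have hp1 : (0 : ℝ) < (Nat.factorial (2 * j) : ℝ) := by positivity
    have hp2 : (0 : ℝ) < (Nat.factorial (4 * j + 2) : ℝ) := by positivity
    have e : (Real.pi ^ 2 * x) ^ (2 * j) = Real.pi ^ (4 * j) * x ^ (2 * j) := by
      rw [mul_pow, ← pow_mul]; congr 2; ring
    have hq : 0 ≤ Real.pi ^ (4 * j) * x ^ (2 * j) := by positivity
    rw [e, div_mul_eq_mul_div, div_le_div_iff₀ hp2 hp1]
    have := mul_le_mul_of_nonneg_left h' hq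
    linarith
  have hsum := Summable.of_nonneg_of_le (fun j => by positivity) hle hs.summable
  have hpi : 1 ≤ Real.sqrt Real.pi := by
    rw [Real.one_le_sqrt]; linarith [Real.pi_gt_three]
  refine ⟨hsum, ?_, ?_⟩
  · have h1 := hsum.tsum_le_tsum hle hs.summable
    rw [hs.tsum_eq] at h1
    exact h1.trans (le_mul_of_one_le_left (Real.cosh_pos _).le hpi)
  · apply mul_le_mul_of_nonneg_left _ (Real.sqrt_nonneg _)
    rw [← Real.cosh_add_sinh]
    have : 0 ≤ Real.sinh (Real.pi ^ 2 * x) := Real.sinh_nonneg_iff.2 (by positivity)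
    linarith
end

section
/- Let 0 < λ < 1 and 0 < u₀ < π/2, and let w ∈ ℂ satisfy (1 − λ)u₀ ≤ Re(w) ≤ (1 + λ)u₀ and |Im(w)| ≤ λu₀. Then sin(Re(w)) / (cosh(Im(w)) − cos(Re(w))) > 2(1 − λ) e^{−π²λ²/24} / (π (1 + λ)² u₀). -/
/-- for `0 < λ < 1`, `0 < u₀ < π/2` and `w` in the box
`(1−λ)u₀ ≤ Re w ≤ (1+λ)u₀`, `|Im w| ≤ λu₀`, one has
`sin(Re w)/(cosh(Im w) − cos(Re w)) > 2(1−λ)e^{−π²λ²/24}/(π(1+λ)²u₀)`. -/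
theorem stmt_18 (lam u₀ : ℝ) (hl1 : 0 < lam) (hl2 : lam < 1)
    (hu1 : 0 < u₀) (hu2 : u₀ < Real.pi / 2) (w : ℂ)
    (hre1 : (1 - lam) * u₀ ≤ w.re) (hre2 : w.re ≤ (1 + lam) * u₀)
    (him : |w.im| ≤ lam * u₀) :
    2 * (1 - lam) * Real.exp (-Real.pi ^ 2 * lam ^ 2 / 24) /
        (Real.pi * (1 + lam) ^ 2 * u₀) <
      Real.sin w.re / (Real.cosh w.im - Real.cos w.re) := by
  have hpi := Real.pi_pos
  have hpi2 := Real.pi_lt_d2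
  set x := w.re with hx
  set y := w.im with hy
  have hp : 0 < (1 - lam) * u₀ := mul_pos (by linarith) hu1
  have hx0 : 0 < x := by linarith
  have hsin : 2 / Real.pi * ((1 - lam) * u₀) ≤ Real.sin x := by
    rcases le_total x (Real.pi / 2) with h | h
    · exact le_trans (mul_le_mul_of_nonneg_left hre1 (by positivity)) (Real.mul_le_sin hx0.le h)
    · rw [← Real.sin_pi_sub]
      have h1 : (1 - lam) * u₀ ≤ Real.pi - x := by nlinarith
      exact le_trans (mul_le_mul_of_nonneg_left h1 (by positivity))
        (Real.mul_le_sin (by linarith) (by linarith))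
  have hcos := Real.one_sub_sq_div_two_le_cos (x := x)
  have hy2 : y ^ 2 ≤ (lam * u₀) ^ 2 := sq_le_sq' (abs_le.1 him).1 (abs_le.1 him).2
  have ha0 : 0 < lam * u₀ := mul_pos hl1 hu1
  have ha : lam * u₀ < 1.575 := by nlinarith
  have hcosh : Real.cosh y ≤ 1 + 2 * y ^ 2 := by
    refine (Real.cosh_le_exp_half_sq y).trans ?_
    obtain ⟨s, hs⟩ : ∃ s, s = y ^ 2 / 6 := ⟨_, rfl⟩
    have hs0 : 0 ≤ s := by rw [hs]; positivity
    have hs1 : s ≤ 0.414 := by rw [hs]; nlinarith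
    have e1 : y ^ 2 / 2 = ((3 : ℕ) : ℝ) * s := by rw [hs]; push_cast; ring
    have e2 : 1 + 2 * y ^ 2 = 1 + 12 * s := by rw [hs]; ring
    rw [e1, e2, Real.exp_nat_mul]
    have h1 : 1 - s ≤ Real.exp (-s) := by linarith [Real.add_one_le_exp (-s)]
    have h2 : Real.exp s * (1 - s) ≤ 1 := by
      have : Real.exp s * Real.exp (-s) = 1 := by rw [← Real.exp_add]; simp
      nlinarith [Real.exp_pos s]
    have h3 : Real.exp s ^ 3 * (1 - s) ^ 3 ≤ 1 := by
      rw [← mul_pow]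
      exact pow_le_one₀ (mul_nonneg (Real.exp_pos s).le (by linarith)) h2
    have h5 : 0 ≤ 9 - 33 * s + 35 * s ^ 2 - 12 * s ^ 3 := by
      nlinarith [mul_nonneg hs0 (sub_nonneg.2 hs1), mul_nonneg (sq_nonneg s) (sub_nonneg.2 hs1), sq_nonneg (s - 0.414)]
    have h4 : 1 ≤ (1 + 12 * s) * (1 - s) ^ 3 := by nlinarith [mul_nonneg hs0 h5]
    exact le_of_mul_le_mul_right (h3.trans h4) (pow_pos (by linarith) 3)
  have hx2 : x ^ 2 ≤ ((1 + lam) * u₀) ^ 2 := pow_le_pow_left₀ hx0.le hre2 2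
  have hD : Real.cosh y - Real.cos x < ((1 + lam) * u₀) ^ 2 := by
    have : (2 * (lam * u₀)) ^ 2 < ((1 + lam) * u₀) ^ 2 :=
      pow_lt_pow_left₀ (by nlinarith) (by positivity) (by norm_num)
    nlinarith
  have hxpi : x < Real.pi := by nlinarith
  have hD0 : 0 < Real.cosh y - Real.cos x := by
    have h1 := Real.one_le_cosh y
    have h2 : Real.cos x < 1 := by
      rw [← Real.cos_zero]
      exact Real.cos_lt_cos_of_nonneg_of_le_pi le_rfl hxpi.le hx0
    linarith
  have hE : Real.exp (-Real.pi ^ 2 * lam ^ 2 / 24) ≤ 1 := by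
    rw [Real.exp_le_one_iff]
    have : 0 ≤ Real.pi ^ 2 * lam ^ 2 := by positivity
    linarith
  have hl : 0 < 1 - lam := by linarith
  calc _ ≤ 2 * (1 - lam) * 1 / (Real.pi * (1 + lam) ^ 2 * u₀) := by gcongr
    _ = (2 / Real.pi * ((1 - lam) * u₀)) / ((1 + lam) * u₀) ^ 2 := by field_simp
    _ < (2 / Real.pi * ((1 - lam) * u₀)) / (Real.cosh y - Real.cos x) :=
        div_lt_div_of_pos_left (by positivity) hD0 hD
    _ ≤ _ := by gcongr
end
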